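/- arXiv:2206.13725 — 5 statements merged into one kernel-verified Lean document; each statement's English description precedes it below -/
import Mathlib

section
/- Let A be an abelian group that is free as a ℤ-module on a subset B, and let A* ⊆ A be the additive submonoid generated by B. Define a relation on A by x ≤ y if and only if y − x ∈ A*. Then ≤ is a partial order on A, and the minimal elements of the set A* \ {0} with respect to ≤ are exactly the elements of B. Consequently, if B′ ⊆ A is any subset that is simultaneously a ℤ-module basis of A and a generating set of the submonoid A*, then B′ = B; in particular, an augmented directed complex admits at most one basis. -/
/-- The submonoid generated by a `ℤ`-basis consists of the elements with nonnegative coordinates. -/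
theorem Module.Basis.mem_addSubmonoidClosure_range_iff {ι A : Type*} [AddCommGroup A]
    (b : Module.Basis ι ℤ A) (x : A) :
    x ∈ AddSubmonoid.closure (Set.range b) ↔ ∀ i, 0 ≤ b.repr x i := by
  classical
  constructor
  · intro hx i
    induction hx using AddSubmonoid.closure_induction with
    | mem y hy =>
      obtain ⟨j, rfl⟩ := hy
      rw [b.repr_self, Finsupp.single_apply]
      split_ifs <;> simp
    | zero => simp
    | add y z _ _ hy hz =>
      rw [map_add, Finsupp.add_apply]
      exact add_nonneg hy hz
  · intro h
    rw [← b.linearCombination_repr x, Finsupp.linearCombination_apply, Finsupp.sum]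
    refine AddSubmonoid.sum_mem _ fun i _ => ?_
    obtain ⟨n, hn⟩ := Int.eq_ofNat_of_zero_le (h i)
    rw [hn, natCast_zsmul]
    exact AddSubmonoid.nsmul_mem _ (AddSubmonoid.subset_closure (Set.mem_range_self i)) n

/-- The partial order on a free abelian group induced by the submonoid generated by a basis. -/
theorem Module.Basis.isPartialOrder_sub_mem_closure_range {ι A : Type*} [AddCommGroup A]
    (b : Module.Basis ι ℤ A) :
    IsPartialOrder A (fun x y => y - x ∈ AddSubmonoid.closure (Set.range b)) where
  refl x := by simp
  trans x y z hxy hyz := by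
    have h := AddSubmonoid.add_mem _ hyz hxy
    rwa [sub_add_sub_cancel] at h
  antisymm x y hxy hyx := by
    rw [b.mem_addSubmonoidClosure_range_iff] at hxy hyx
    refine b.ext_elem fun i => ?_
    have h₁ := hxy i
    have h₂ := hyx i
    rw [map_sub, Finsupp.sub_apply] at h₁ h₂
    lia

/-- The basis elements are the minimal nonzero elements of the submonoid they generate. -/
theorem Module.Basis.setOf_minimal_closure_range {ι A : Type*} [AddCommGroup A]
    (b : Module.Basis ι ℤ A) :
    {x : A | x ∈ AddSubmonoid.closure (Set.range b) ∧ x ≠ 0 ∧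
      ∀ y ∈ AddSubmonoid.closure (Set.range b), y ≠ 0 →
        x - y ∈ AddSubmonoid.closure (Set.range b) → y = x} = Set.range b := by
  classical
  have exists_coord_ne_zero {y : A} (hy : y ≠ 0) : ∃ i, b.repr y i ≠ 0 := by
    by_contra! h
    exact hy (b.ext_elem fun i => by simpa using h i)
  ext x
  constructor
  · rintro ⟨hx, hx0, hmin⟩
    obtain ⟨i, hi⟩ := exists_coord_ne_zero hx0
    refine ⟨i, hmin (b i) (AddSubmonoid.subset_closure ⟨i, rfl⟩) (b.ne_zero i) ?_⟩
    rw [b.mem_addSubmonoidClosure_range_iff] at hx ⊢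
    intro j
    have hj := hx j
    rw [map_sub, Finsupp.sub_apply, b.repr_self, Finsupp.single_apply]
    split_ifs with hij
    · subst hij
      lia
    · lia
  · rintro ⟨i, rfl⟩
    refine ⟨AddSubmonoid.subset_closure ⟨i, rfl⟩, b.ne_zero i, fun y hy hy0 hle => ?_⟩
    obtain ⟨k, hk⟩ := exists_coord_ne_zero hy0
    rw [b.mem_addSubmonoidClosure_range_iff] at hy hle
    simp only [map_sub, Finsupp.sub_apply, b.repr_self, Finsupp.single_apply] at hle
    have hik : i = k := by
      by_contra hne
      have h₁ := hy k
      have h₂ := hle k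
      rw [if_neg hne] at h₂
      lia
    subst hik
    refine b.ext_elem fun j => ?_
    rw [b.repr_self, Finsupp.single_apply]
    have h₁ := hy j
    have h₂ := hle j
    split_ifs with hij
    · subst hij
      rw [if_pos rfl] at h₂
      lia
    · rw [if_neg hij] at h₂
      lia

/-- A linearly independent spanning set is the range of a basis. -/
theorem exists_basis_range_eq_of_linearIndependent_of_span_eq_top {A : Type*} [AddCommGroup A]
    {B : Set A} (hindep : LinearIndependent ℤ ((↑) : B → A))
    (hspan : Submodule.span ℤ B = ⊤) :
    ∃ b : Module.Basis B ℤ A, Set.range b = B :=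
  ⟨.mk hindep (by rw [Subtype.range_coe, hspan]), by
    rw [Module.Basis.coe_mk, Subtype.range_coe]⟩


/-- **Uniqueness of the basis of an augmented directed complex.**
Let `A` be an abelian group that is free as a `ℤ`-module on a subset `B`
(`B` is linearly independent over `ℤ` and spans `A`), and let `A* = AddSubmonoid.closure B`
be the additive submonoid generated by `B`.  Define `x ≤ y ↔ y - x ∈ A*`.  Then:
(1) `≤` is a partial order on `A`;
(2) the minimal elements of `A* \ {0}` with respect to `≤` are exactly the elements of `B`;
(3) consequently any subset `B'` of `A` which is simultaneously a `ℤ`-basis of `A` and a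
generating set of the submonoid `A*` equals `B` — so a basis is unique. -/
theorem unique_basis_of_augmented_directed_complex
    (A : Type*) [AddCommGroup A] (B : Set A)
    (hindep : LinearIndependent ℤ ((↑) : B → A))
    (hspan : Submodule.span ℤ B = ⊤) :
    IsPartialOrder A (fun x y => y - x ∈ AddSubmonoid.closure B) ∧
    {x : A | x ∈ AddSubmonoid.closure B ∧ x ≠ 0 ∧
      ∀ y ∈ AddSubmonoid.closure B, y ≠ 0 → x - y ∈ AddSubmonoid.closure B → y = x} = B ∧
    (∀ B' : Set A, LinearIndependent ℤ ((↑) : B' → A) → Submodule.span ℤ B' = ⊤ →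
      AddSubmonoid.closure B' = AddSubmonoid.closure B → B' = B) := by
  obtain ⟨b, hb⟩ := exists_basis_range_eq_of_linearIndependent_of_span_eq_top hindep hspan
  have hpo := b.isPartialOrder_sub_mem_closure_range
  have hmin := b.setOf_minimal_closure_range
  rw [hb] at hpo hmin
  refine ⟨hpo, hmin, fun B' hindep' hspan' hclosure => ?_⟩
  obtain ⟨b', hb'⟩ := exists_basis_range_eq_of_linearIndependent_of_span_eq_top hindep' hspan'
  have hmin' := b'.setOf_minimal_closure_range
  rw [hb', hclosure] at hmin'
  exact hmin'.symm.trans hmin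
end

section
/- Let K be an augmented directed complex admitting a basis B. If B is strongly loop-free, then B is loop-free. -/
/-!
An augmented directed complex `K` *with a basis* `B = (B_n)` is (up to canonical isomorphism)
given by the following data: a type `B` of basis elements with a degree function
`deg : B → ℕ`, the graded group `K` being the free abelian group `B →₀ ℤ` on `B`
(with `K_n` the span of the degree-`n` basis elements), a differential
`D : (B →₀ ℤ) →ₗ[ℤ] (B →₀ ℤ)` with `D ∘ D = 0` which lowers degree by one
(sending degree-`0` basis elements to `0`), an augmentation `e` vanishing on the image
of degree-`1` elements, and positivity submonoids `K_n*` generated by the basis.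
-/

/-- The positive part `x₊` of an element of a free abelian group. -/
noncomputable def pPart {B : Type*} (x : B →₀ ℤ) : B →₀ ℤ :=
  Finsupp.mapRange (fun z => max z 0) (by simp) x

/-- The negative part `x₋`, so that `x = x₊ - x₋`. -/
noncomputable def nPart {B : Type*} (x : B →₀ ℤ) : B →₀ ℤ := pPart (-x)

/-- Iterated source: `srcIter D (i - k) x = ⟨x⟩_k^0` for `x` of degree `i`,
via the downward recursion `⟨x⟩_{k-1}^0 = (d ⟨x⟩_k^0)₋`. -/
noncomputable def srcIter {B : Type*} (D : (B →₀ ℤ) →ₗ[ℤ] (B →₀ ℤ)) :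
    ℕ → (B →₀ ℤ) → (B →₀ ℤ)
  | 0, x => x
  | m + 1, x => nPart (D (srcIter D m x))

/-- Iterated target: `tgtIter D (i - k) x = ⟨x⟩_k^1` for `x` of degree `i`,
via the downward recursion `⟨x⟩_{k-1}^1 = (d ⟨x⟩_k^1)₊`. -/
noncomputable def tgtIter {B : Type*} (D : (B →₀ ℤ) →ₗ[ℤ] (B →₀ ℤ)) :
    ℕ → (B →₀ ℤ) → (B →₀ ℤ)
  | 0, x => x
  | m + 1, x => pPart (D (tgtIter D m x))

/-- The generating relation of the preorder `≤ᵢ` on the basis: `x` is related to `y`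
whenever `deg x > i`, `deg y > i` and `supp ⟨x⟩_i^1 ∩ supp ⟨y⟩_i^0 ≠ ∅`. -/
def relStep {B : Type*} [DecidableEq B] (deg : B → ℕ)
    (D : (B →₀ ℤ) →ₗ[ℤ] (B →₀ ℤ)) (i : ℕ) (x y : B) : Prop :=
  i < deg x ∧ i < deg y ∧
    ((tgtIter D (deg x - i) (Finsupp.single x 1)).support ∩
      (srcIter D (deg y - i) (Finsupp.single y 1)).support).Nonempty

/-- The generating relation of the preorder `≤_ℕ` on the basis: `x` related to `y`
whenever `x ∈ supp (d y)₋` or `y ∈ supp (d x)₊`. -/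
def relNStep {B : Type*} (D : (B →₀ ℤ) →ₗ[ℤ] (B →₀ ℤ)) (x y : B) : Prop :=
  x ∈ (nPart (D (Finsupp.single y 1))).support ∨
  y ∈ (pPart (D (Finsupp.single x 1))).support

theorem mem_support_pPart {B : Type*} {x : B →₀ ℤ} {b : B} :
    b ∈ (pPart x).support ↔ 0 < x b := by
  simp [pPart]

theorem pPart_apply_nonneg {B : Type*} (x : B →₀ ℤ) (b : B) : 0 ≤ pPart x b := by
  simp [pPart]

/-- A basis element occurring positively in the image of a nonnegative element occurs positively
in the image of some basis element of its support. -/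
theorem exists_mem_support_pPart_map_single {B : Type*} (L : (B →₀ ℤ) →ₗ[ℤ] (B →₀ ℤ))
    {t : B →₀ ℤ} (ht : ∀ b, 0 ≤ t b) {z : B} (hz : z ∈ (pPart (L t)).support) :
    ∃ b ∈ t.support, z ∈ (pPart (L (Finsupp.single b 1))).support := by
  rw [mem_support_pPart] at hz
  have hsum : L t z = ∑ b ∈ t.support, t b * L (Finsupp.single b 1) z := by
    conv_lhs => rw [← Finsupp.sum_single t]
    rw [Finsupp.sum, map_sum, Finsupp.finsetSum_apply]
    refine Finset.sum_congr rfl fun b _ => ?_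
    rw [← Finsupp.smul_single_one, map_smul, Finsupp.smul_apply, smul_eq_mul]
  rw [hsum] at hz
  obtain ⟨b, hb, hpos⟩ := Finset.exists_lt_of_sum_lt (Finset.sum_const_zero.trans_lt hz)
  exact ⟨b, hb, mem_support_pPart.2 (pos_of_mul_pos_right hpos (ht b))⟩

theorem tgtIter_single_nonneg {B : Type*} (D : (B →₀ ℤ) →ₗ[ℤ] (B →₀ ℤ)) (m : ℕ) (x b : B) :
    0 ≤ tgtIter D m (Finsupp.single x 1) b := by
  cases m with
  | zero => exact (Finsupp.single_nonneg.2 zero_le_one : (0 : B →₀ ℤ) ≤ Finsupp.single x 1) b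
  | succ m => exact pPart_apply_nonneg _ b

theorem srcIter_single_nonneg {B : Type*} (D : (B →₀ ℤ) →ₗ[ℤ] (B →₀ ℤ)) (m : ℕ) (x b : B) :
    0 ≤ srcIter D m (Finsupp.single x 1) b := by
  cases m with
  | zero => exact (Finsupp.single_nonneg.2 zero_le_one : (0 : B →₀ ℤ) ≤ Finsupp.single x 1) b
  | succ m => exact pPart_apply_nonneg _ b

theorem reflTransGen_relNStep_of_mem_tgtIter {B : Type*} (D : (B →₀ ℤ) →ₗ[ℤ] (B →₀ ℤ)) (m : ℕ)
    {x z : B} (hz : z ∈ (tgtIter D m (Finsupp.single x 1)).support) :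
    Relation.ReflTransGen (relNStep D) x z := by
  induction m generalizing z with
  | zero =>
    obtain rfl := Finset.mem_singleton.1 (Finsupp.support_single_subset hz)
    exact .refl
  | succ m ih =>
    obtain ⟨b, hb, hzb⟩ :=
      exists_mem_support_pPart_map_single D (tgtIter_single_nonneg D m x) hz
    exact (ih hb).tail (Or.inr hzb)

theorem reflTransGen_relNStep_of_mem_srcIter {B : Type*} (D : (B →₀ ℤ) →ₗ[ℤ] (B →₀ ℤ)) (m : ℕ)
    {y z : B} (hz : z ∈ (srcIter D m (Finsupp.single y 1)).support) :
    Relation.ReflTransGen (relNStep D) z y := by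
  induction m generalizing z with
  | zero =>
    obtain rfl := Finset.mem_singleton.1 (Finsupp.support_single_subset hz)
    exact .refl
  | succ m ih =>
    obtain ⟨b, hb, hzb⟩ :=
      exists_mem_support_pPart_map_single (-D) (srcIter_single_nonneg D m y) hz
    exact (ih hb).head (Or.inl hzb)

theorem reflTransGen_relNStep_of_relStep {B : Type*} [DecidableEq B] {deg : B → ℕ}
    {D : (B →₀ ℤ) →ₗ[ℤ] (B →₀ ℤ)} {i : ℕ} {x y : B} (h : relStep deg D i x y) :
    Relation.ReflTransGen (relNStep D) x y := by
  obtain ⟨-, -, z, hz⟩ := h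
  rw [Finset.mem_inter] at hz
  exact (reflTransGen_relNStep_of_mem_tgtIter D _ hz.1).trans
    (reflTransGen_relNStep_of_mem_srcIter D _ hz.2)

/-- **Steiner**: if the basis of an augmented directed complex is strongly loop-free
(the reflexive–transitive closure of `≤_ℕ`'s generating relation is antisymmetric),
then it is loop-free (each reflexive–transitive closure `≤ᵢ` is antisymmetric). -/
theorem loopFree_of_stronglyLoopFree
    (B : Type*) [DecidableEq B] (deg : B → ℕ)
    (D : (B →₀ ℤ) →ₗ[ℤ] (B →₀ ℤ))
    (hDD : D ∘ₗ D = 0)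
    (hdeg : ∀ b : B, ∀ c ∈ (D (Finsupp.single b 1)).support, deg c + 1 = deg b)
    (e : (B →₀ ℤ) →ₗ[ℤ] ℤ)
    (he : ∀ x : B →₀ ℤ, (∀ b ∈ x.support, deg b = 1) → e (D x) = 0)
    (hstrong : AntiSymmetric (Relation.ReflTransGen (relNStep D))) :
    ∀ i : ℕ, AntiSymmetric (Relation.ReflTransGen (relStep deg D i)) := by
  intro i x y hxy hyx
  have hle : Relation.ReflTransGen (relStep deg D i) ≤ Relation.ReflTransGen (relNStep D) := by
    intro a b hab
    induction hab with
    | refl => exact .refl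
    | tail _ h ih => exact ih.trans (reflTransGen_relNStep_of_relStep h)
  exact hstrong (hle x y hxy) (hle y x hyx)
end

section
/- Let n ≥ 1 and consider the n-globe complex G(n). Suppose given x_n ∈ G(n)_n* with x_n ≠ 0 and, for each 0 ≤ k ≤ n−1 and ε ∈ {0,1}, elements x_k^ε ∈ G(n)_k*, such that: d(x_n) = x_{n−1}^1 − x_{n−1}^0; d(x_k^0) = d(x_k^1) = x_{k−1}^1 − x_{k−1}^0 for all 1 ≤ k ≤ n−1; and e(x_0^0) = e(x_0^1) = 1. Then x_n = υ and x_k^0 = β_k, x_k^1 = τ_k for all 0 ≤ k ≤ n−1. (Hence the ω-category ν(λ(n̄)) has a unique nondegenerate n-cell, namely the canonical one.) -/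
/-- The basis of the `n`-globe complex `G(n) = λ(n̄)`: a top generator `υ` in degree `n`
and generators `β_k, τ_k` in each degree `k < n`. -/
inductive GlobeBasis (n : ℕ) : Type
  | top : GlobeBasis n
  | β : Fin n → GlobeBasis n
  | τ : Fin n → GlobeBasis n
  deriving DecidableEq

/-- The underlying graded abelian group of the `n`-globe complex: the free abelian
group on `GlobeBasis n`. -/
abbrev Globe (n : ℕ) : Type := GlobeBasis n →₀ ℤ

/-- The degree of a basis element of `G(n)`. -/
def degG (n : ℕ) : GlobeBasis n → ℕ
  | .top => n
  | .β k => k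
  | .τ k => k

/-- The differential of `G(n)` on basis elements:
`d(υ) = τ_{n-1} - β_{n-1}` and `d(β_k) = d(τ_k) = τ_{k-1} - β_{k-1}` for `k ≥ 1`
(`0` in degree `0`). -/
noncomputable def dGB (n : ℕ) : GlobeBasis n → Globe n
  | .top =>
      if h : 0 < n then
        Finsupp.single (GlobeBasis.τ ⟨n - 1, by omega⟩) 1
          - Finsupp.single (GlobeBasis.β ⟨n - 1, by omega⟩) 1
      else 0
  | .β k =>
      if h : 0 < (k : ℕ) then
        Finsupp.single (GlobeBasis.τ ⟨(k : ℕ) - 1, lt_of_le_of_lt (Nat.sub_le _ _) k.isLt⟩) 1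
          - Finsupp.single (GlobeBasis.β ⟨(k : ℕ) - 1, lt_of_le_of_lt (Nat.sub_le _ _) k.isLt⟩) 1
      else 0
  | .τ k =>
      if h : 0 < (k : ℕ) then
        Finsupp.single (GlobeBasis.τ ⟨(k : ℕ) - 1, lt_of_le_of_lt (Nat.sub_le _ _) k.isLt⟩) 1
          - Finsupp.single (GlobeBasis.β ⟨(k : ℕ) - 1, lt_of_le_of_lt (Nat.sub_le _ _) k.isLt⟩) 1
      else 0

/-- The differential of the globe complex `G(n)`, as a `ℤ`-linear endomorphism of the
free abelian group on the graded basis. -/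
noncomputable def DG (n : ℕ) : Globe n →ₗ[ℤ] Globe n :=
  Finsupp.linearCombination ℤ (dGB n)

/-- `memPos n k x` says that `x` lies in the degree-`k` positivity submonoid `G(n)_k*`:
`x` is homogeneous of degree `k` and has nonnegative coordinates. -/
def memPos (n k : ℕ) (x : Globe n) : Prop :=
  (∀ b ∈ x.support, degG n b = k) ∧ ∀ b, 0 ≤ x b

/-- The augmentation `e : G(n)_0 → ℤ`, `e(a·β_0 + c·τ_0) = a + c` (extended by the
degree-`0` coordinates to the whole group). -/
noncomputable def augG (n : ℕ) (x : Globe n) : ℤ :=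
  if h : 0 < n then x (GlobeBasis.β ⟨0, h⟩) + x (GlobeBasis.τ ⟨0, h⟩) else 0

namespace GlobeBasis

theorem eq_top_of_degG_eq {n : ℕ} : ∀ {b : GlobeBasis n}, degG n b = n → b = top
  | top, _ => rfl
  | β j, h => absurd h j.isLt.ne
  | τ j, h => absurd h j.isLt.ne

theorem eq_or_eq_of_degG_eq {n k : ℕ} (hk : k < n) :
    ∀ {b : GlobeBasis n}, degG n b = k → b = β ⟨k, hk⟩ ∨ b = τ ⟨k, hk⟩
  | top, h => absurd h hk.ne'
  | β _, h => .inl (congrArg β (Fin.ext h))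
  | τ _, h => .inr (congrArg τ (Fin.ext h))

end GlobeBasis

theorem memPos.eq_single_top {n : ℕ} {y : Globe n} (hy : memPos n n y) :
    y = Finsupp.single GlobeBasis.top (y GlobeBasis.top) := by
  ext b
  by_cases hb : b = GlobeBasis.top
  · simp [hb]
  · rw [Finsupp.single_eq_of_ne hb]
    by_contra h
    exact hb (GlobeBasis.eq_top_of_degG_eq (hy.1 b (Finsupp.mem_support_iff.2 h)))

theorem memPos.eq_single_add_single {n k : ℕ} {y : Globe n} (hk : k < n) (hy : memPos n k y) :
    y = Finsupp.single (GlobeBasis.β ⟨k, hk⟩) (y (GlobeBasis.β ⟨k, hk⟩))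
      + Finsupp.single (GlobeBasis.τ ⟨k, hk⟩) (y (GlobeBasis.τ ⟨k, hk⟩)) := by
  ext b
  by_cases hβ : b = GlobeBasis.β ⟨k, hk⟩
  · simp [hβ]
  by_cases hτ : b = GlobeBasis.τ ⟨k, hk⟩
  · simp [hτ]
  rw [Finsupp.add_apply, Finsupp.single_eq_of_ne hβ, Finsupp.single_eq_of_ne hτ, add_zero]
  by_contra h
  exact (GlobeBasis.eq_or_eq_of_degG_eq hk (hy.1 b (Finsupp.mem_support_iff.2 h))).elim hβ hτ

/-- The `τ`-coordinate of the differential of a top-degree element. -/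
theorem memPos.DG_apply_τ_top {n : ℕ} {y : Globe n} (hn : n - 1 < n) (hy : memPos n n y) :
    DG n y (GlobeBasis.τ ⟨n - 1, hn⟩) = y GlobeBasis.top := by
  conv_lhs => rw [hy.eq_single_top]
  simp [DG, dGB, Nat.zero_lt_of_lt hn]

/-- The `τ`-coordinate of the differential of an element of intermediate degree. -/
theorem memPos.DG_apply_τ {n k : ℕ} {y : Globe n} (hk : k + 1 < n) (hy : memPos n (k + 1) y) :
    DG n y (GlobeBasis.τ ⟨k, by omega⟩)
      = y (GlobeBasis.β ⟨k + 1, hk⟩) + y (GlobeBasis.τ ⟨k + 1, hk⟩) := by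
  conv_lhs => rw [hy.eq_single_add_single hk]
  simp [DG, dGB]

/-- Nonnegative pairs `(b k ε, t k ε)` whose sums `s k` start at `1`, end positive, and satisfy
`s (k + 1) = t k 1 - t k 0` are the coordinates of the canonical generators. -/
theorem coords_eq_of_sum_eq {n : ℕ} {b t : ℕ → Fin 2 → ℤ} {s : ℕ → ℤ}
    (hb : ∀ k < n, ∀ ε, 0 ≤ b k ε) (ht : ∀ k < n, ∀ ε, 0 ≤ t k ε)
    (hs : ∀ k < n, ∀ ε, b k ε + t k ε = s k)
    (hd : ∀ k < n, t k 1 - t k 0 = s (k + 1)) (h0 : s 0 = 1) (hn : 0 < s n) :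
    s n = 1 ∧ ∀ k < n, b k 0 = 1 ∧ t k 0 = 0 ∧ b k 1 = 0 ∧ t k 1 = 1 := by
  have pos : ∀ k ≤ n, 0 < s k := fun k hk => by
    induction hk using Nat.decreasingInduction with
    | self => exact hn
    | of_succ k hk ih =>
      linarith [hb k hk 1, ht k hk 0, hs k hk 1, hd k hk]
  have one : ∀ k ≤ n, s k = 1 := fun k => by
    induction k with
    | zero => exact fun _ => h0
    | succ k ih =>
      intro hk
      have := ih (by omega)
      have := pos (k + 1) hk
      linarith [hb k hk 1, ht k hk 0, hs k hk 1, hd k hk]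
  refine ⟨one n le_rfl, fun k hk => ?_⟩
  have := one k hk.le
  have := one (k + 1) hk
  have := hb k hk 1
  have := ht k hk 0
  have := hs k hk 0
  have := hs k hk 1
  have := hd k hk
  omega

/-- **Uniqueness of the nondegenerate top cell of the globe.**  Let `n ≥ 1`.  Given
`x_n ∈ G(n)_n*` nonzero and `x_k^ε ∈ G(n)_k*` for `0 ≤ k ≤ n-1`, `ε ∈ {0,1}`, with
`d(x_n) = x_{n-1}^1 - x_{n-1}^0`, `d(x_k^0) = d(x_k^1) = x_{k-1}^1 - x_{k-1}^0` for
`1 ≤ k ≤ n-1`, and `e(x_0^0) = e(x_0^1) = 1`, one has `x_n = υ` and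
`x_k^0 = β_k`, `x_k^1 = τ_k` for all `k ≤ n-1`.  (Hence `ν(λ(n̄))` has a unique
nondegenerate `n`-cell.) -/
theorem globe_unique_top_cell (n : ℕ) (hn : 1 ≤ n)
    (xn : Globe n) (x : ℕ → Fin 2 → Globe n)
    (hxn : memPos n n xn) (hxn0 : xn ≠ 0)
    (hx : ∀ k ≤ n - 1, ∀ ε : Fin 2, memPos n k (x k ε))
    (hdtop : DG n xn = x (n - 1) 1 - x (n - 1) 0)
    (hd : ∀ k, 1 ≤ k → k ≤ n - 1 → ∀ ε : Fin 2,
        DG n (x k ε) = x (k - 1) 1 - x (k - 1) 0)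
    (he : ∀ ε : Fin 2, augG n (x 0 ε) = 1) :
    xn = Finsupp.single GlobeBasis.top 1 ∧
    ∀ k (hk : k ≤ n - 1),
      x k 0 = Finsupp.single (GlobeBasis.β ⟨k, by omega⟩) 1 ∧
      x k 1 = Finsupp.single (GlobeBasis.τ ⟨k, by omega⟩) 1 := by
  have hlt : n - 1 < n := by omega
  let b : ℕ → Fin 2 → ℤ := fun k ε => if h : k < n then x k ε (.β ⟨k, h⟩) else 0
  let t : ℕ → Fin 2 → ℤ := fun k ε => if h : k < n then x k ε (.τ ⟨k, h⟩) else 0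
  let s : ℕ → ℤ := fun k => if k < n then b k 0 + t k 0 else xn .top
  have hb {k} (hk : k < n) (ε) : b k ε = x k ε (.β ⟨k, hk⟩) := dif_pos hk
  have ht {k} (hk : k < n) (ε) : t k ε = x k ε (.τ ⟨k, hk⟩) := dif_pos hk
  have hs {k} (hk : k < n) : s k = b k 0 + t k 0 := if_pos hk
  have hsn : s n = xn .top := if_neg (lt_irrefl n)
  have hxk {k} (hk : k < n) (ε) : memPos n k (x k ε) := hx k (by omega) ε
  have he' (ε) : b 0 ε + t 0 ε = 1 := by
    rw [hb hn, ht hn]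
    simpa [augG, Nat.zero_lt_of_lt hn] using he ε
  have hsucc {k} (hk : k + 1 < n) (ε) : b (k + 1) ε + t (k + 1) ε = t k 1 - t k 0 := by
    have hk' : k < n := by omega
    rw [hb hk, ht hk, ht hk', ht hk', ← (hxk hk ε).DG_apply_τ hk,
      hd (k + 1) (by omega) (by omega) ε]
    rfl
  have htop : xn .top = t (n - 1) 1 - t (n - 1) 0 := by
    rw [ht hlt, ht hlt, ← hxn.DG_apply_τ_top hlt, hdtop]
    rfl
  have hpos : 0 < xn .top := (hxn.2 _).lt_of_ne' fun h => hxn0 <| by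
    rw [hxn.eq_single_top, h, Finsupp.single_zero]
  obtain ⟨h1, h2⟩ := coords_eq_of_sum_eq (n := n) (b := b) (t := t) (s := s)
    (fun k hk ε => hb hk ε ▸ (hxk hk ε).2 _) (fun k hk ε => ht hk ε ▸ (hxk hk ε).2 _)
    (fun k hk ε => by
      rw [hs hk]
      cases k with
      | zero => rw [he', he']
      | succ k => rw [hsucc hk, hsucc hk])
    (fun k hk => by
      rcases Nat.lt_or_ge (k + 1) n with h | h
      · rw [hs h, hsucc h]
      · obtain rfl : n = k + 1 := by omega
        rw [hsn, htop, Nat.add_sub_cancel])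
    (by rw [hs hn, he']) (hsn ▸ hpos)
  refine ⟨by rw [hxn.eq_single_top, ← hsn, h1], fun k hk => ?_⟩
  have hk' : k < n := by omega
  obtain ⟨hb0, ht0, hb1, ht1⟩ := h2 k hk'
  constructor
  · rw [(hxk hk' 0).eq_single_add_single hk', ← hb hk', ← ht hk', hb0, ht0,
      Finsupp.single_zero, add_zero]
  · rw [(hxk hk' 1).eq_single_add_single hk', ← hb hk', ← ht hk', hb1, ht1,
      Finsupp.single_zero, zero_add]
end

section
/- For every n ≥ 3, the graded subgroups L, M, and R of the chain complex T = I ⊗ G(n+1) are each closed under the differential of T (i.e., each is a chain subcomplex of T), and each is free abelian with the listed spanning elements as a basis. -/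
/-- The basis of the tensor complex `T = I ⊗ G(n+1)` (interval tensor `(n+1)`-globe):
`hv = h⊗υ`, `lv = ℓ⊗υ`, `rv = r⊗υ`, `hb k = h⊗β_k`, `ht k = h⊗τ_k`,
`lb k = ℓ⊗β_k`, `lt' k = ℓ⊗τ_k`, `rb k = r⊗β_k`, `rt k = r⊗τ_k` for `0 ≤ k ≤ n`. -/
inductive TB (n : ℕ) : Type
  | hv : TB n
  | lv : TB n
  | rv : TB n
  | hb : Fin (n + 1) → TB n
  | ht : Fin (n + 1) → TB n
  | lb : Fin (n + 1) → TB n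
  | lt' : Fin (n + 1) → TB n
  | rb : Fin (n + 1) → TB n
  | rt : Fin (n + 1) → TB n
  deriving DecidableEq

/-- The underlying graded abelian group of `T = I ⊗ G(n+1)`: free abelian on `TB n`. -/
abbrev TT (n : ℕ) : Type := TB n →₀ ℤ

/-- The degree of a basis element of `T = I ⊗ G(n+1)`. -/
def degT (n : ℕ) : TB n → ℕ
  | .hv => n + 2
  | .lv => n + 1
  | .rv => n + 1
  | .hb k => (k : ℕ) + 1
  | .ht k => (k : ℕ) + 1
  | .lb k => k
  | .lt' k => k
  | .rb k => k
  | .rt k => k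

/-- The basis vector of `T` corresponding to a basis element. -/
noncomputable def eT {n : ℕ} (b : TB n) : TT n := Finsupp.single b 1

/-- The Koszul differential of `T = I ⊗ G(n+1)` on basis elements:
`d(x ⊗ y) = d(x) ⊗ y + (-1)^{deg x} x ⊗ d(y)`, with `d(h) = r - ℓ`,
`d(υ) = τ_n - β_n` and `d(β_k) = d(τ_k) = τ_{k-1} - β_{k-1}` (`0` for `k = 0`). -/
noncomputable def dTB (n : ℕ) : TB n → TT n
  | .hv => eT .rv - eT .lv - eT (.ht (Fin.last n)) + eT (.hb (Fin.last n))
  | .lv => eT (.lt' (Fin.last n)) - eT (.lb (Fin.last n))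
  | .rv => eT (.rt (Fin.last n)) - eT (.rb (Fin.last n))
  | .hb k => eT (.rb k) - eT (.lb k) -
      (if 0 < (k : ℕ) then
        eT (.ht ⟨(k : ℕ) - 1, lt_of_le_of_lt (Nat.sub_le _ _) k.isLt⟩)
          - eT (.hb ⟨(k : ℕ) - 1, lt_of_le_of_lt (Nat.sub_le _ _) k.isLt⟩)
      else 0)
  | .ht k => eT (.rt k) - eT (.lt' k) -
      (if 0 < (k : ℕ) then
        eT (.ht ⟨(k : ℕ) - 1, lt_of_le_of_lt (Nat.sub_le _ _) k.isLt⟩)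
          - eT (.hb ⟨(k : ℕ) - 1, lt_of_le_of_lt (Nat.sub_le _ _) k.isLt⟩)
      else 0)
  | .lb k =>
      if 0 < (k : ℕ) then
        eT (.lt' ⟨(k : ℕ) - 1, lt_of_le_of_lt (Nat.sub_le _ _) k.isLt⟩)
          - eT (.lb ⟨(k : ℕ) - 1, lt_of_le_of_lt (Nat.sub_le _ _) k.isLt⟩)
      else 0
  | .lt' k =>
      if 0 < (k : ℕ) then
        eT (.lt' ⟨(k : ℕ) - 1, lt_of_le_of_lt (Nat.sub_le _ _) k.isLt⟩)
          - eT (.lb ⟨(k : ℕ) - 1, lt_of_le_of_lt (Nat.sub_le _ _) k.isLt⟩)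
      else 0
  | .rb k =>
      if 0 < (k : ℕ) then
        eT (.rt ⟨(k : ℕ) - 1, lt_of_le_of_lt (Nat.sub_le _ _) k.isLt⟩)
          - eT (.rb ⟨(k : ℕ) - 1, lt_of_le_of_lt (Nat.sub_le _ _) k.isLt⟩)
      else 0
  | .rt k =>
      if 0 < (k : ℕ) then
        eT (.rt ⟨(k : ℕ) - 1, lt_of_le_of_lt (Nat.sub_le _ _) k.isLt⟩)
          - eT (.rb ⟨(k : ℕ) - 1, lt_of_le_of_lt (Nat.sub_le _ _) k.isLt⟩)
      else 0

/-- The differential of `T = I ⊗ G(n+1)` as a `ℤ`-linear endomorphism. -/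
noncomputable def DT (n : ℕ) : TT n →ₗ[ℤ] TT n :=
  Finsupp.linearCombination ℤ (dTB n)

/-- Degree-`m` generators of the subcomplex `L` (the image of `λ([2];(n̄,[0]))`). -/
def LGen (n : ℕ) : ℕ → Set (TT n)
  | 0 => {eT (.lb 0), eT (.lt' 0), eT (.rt 0)}
  | 1 => {eT (.lb 1), eT (.lt' 1), eT (.ht 0)}
  | m + 2 =>
      if h : m + 2 ≤ n then {eT (.lb ⟨m + 2, by omega⟩), eT (.lt' ⟨m + 2, by omega⟩)}
      else if m + 2 = n + 1 then {eT .lv}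
      else ∅

/-- Degree-`m` generators of the subcomplex `R` (the image of `λ([2];([0],n̄))`). -/
def RGen (n : ℕ) : ℕ → Set (TT n)
  | 0 => {eT (.lb 0), eT (.rb 0), eT (.rt 0)}
  | 1 => {eT (.rb 1), eT (.rt 1), eT (.hb 0)}
  | m + 2 =>
      if h : m + 2 ≤ n then {eT (.rb ⟨m + 2, by omega⟩), eT (.rt ⟨m + 2, by omega⟩)}
      else if m + 2 = n + 1 then {eT .rv}
      else ∅

/-- Degree-`m` generators of the subcomplex `M` (the image of `λ([1];([1]⊗n̄))`). -/
def MGen (n : ℕ) : ℕ → Set (TT n)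
  | 0 => {eT (.lb 0), eT (.rt 0)}
  | 1 => {eT (.lb 1) + eT (.ht 0), eT (.lt' 1) + eT (.ht 0),
          eT (.hb 0) + eT (.rb 1), eT (.hb 0) + eT (.rt 1)}
  | m + 2 =>
      if h : m + 2 ≤ n then
        {eT (.lb ⟨m + 2, by omega⟩), eT (.lt' ⟨m + 2, by omega⟩),
         eT (.rb ⟨m + 2, by omega⟩), eT (.rt ⟨m + 2, by omega⟩),
         eT (.hb ⟨m + 1, by omega⟩), eT (.ht ⟨m + 1, by omega⟩)}
      else if m + 2 = n + 1 then {eT .lv, eT .rv, eT (.hb (Fin.last n)), eT (.ht (Fin.last n))}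
      else if m + 2 = n + 2 then {eT .hv}
      else ∅

/-- All generators of `L`. -/
def LSet (n : ℕ) : Set (TT n) := ⋃ m, LGen n m

/-- All generators of `M`. -/
def MSet (n : ℕ) : Set (TT n) := ⋃ m, MGen n m

/-- All generators of `R`. -/
def RSet (n : ℕ) : Set (TT n) := ⋃ m, RGen n m

/-- The graded subgroup `L` of `T`. -/
noncomputable def Lsub (n : ℕ) : Submodule ℤ (TT n) := Submodule.span ℤ (LSet n)

/-- The graded subgroup `M` of `T`. -/
noncomputable def Msub (n : ℕ) : Submodule ℤ (TT n) := Submodule.span ℤ (MSet n)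

/-- The graded subgroup `R` of `T`. -/
noncomputable def Rsub (n : ℕ) : Submodule ℤ (TT n) := Submodule.span ℤ (RSet n)

/-- The degree-`m` graded piece `T_m` of `T`, spanned by the degree-`m` basis elements. -/
noncomputable def Tdeg (n m : ℕ) : Submodule ℤ (TT n) :=
  Submodule.span ℤ {x : TT n | ∃ b : TB n, degT n b = m ∧ x = eT b}

theorem DT_eT {n : ℕ} (b : TB n) : DT n (eT b) = dTB n b := by
  simp [DT, eT]

theorem eT_inj {n : ℕ} {b c : TB n} : eT b = eT c ↔ b = c :=
  Finsupp.single_left_inj one_ne_zero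

theorem map_mem_span_of_forall_mem {M : Type*} [AddCommGroup M] {s : Set M} {f : M →ₗ[ℤ] M}
    (h : ∀ x ∈ s, f x ∈ Submodule.span ℤ s) :
    ∀ x ∈ Submodule.span ℤ s, f x ∈ Submodule.span ℤ s := fun _ hx =>
  (Submodule.span_le (p := (Submodule.span ℤ s).comap f)).2 h hx

theorem linearIndependent_eT (n : ℕ) : LinearIndependent ℤ (eT : TB n → TT n) :=
  Finsupp.linearIndependent_single_one ℤ (TB n)

theorem LinearIndependent.coe_of_subset_range {ι M : Type*} [AddCommGroup M] {v : ι → M}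
    (hv : LinearIndependent ℤ v) {s : Set M} (hs : s ⊆ Set.range v) :
    LinearIndependent ℤ ((↑) : s → M) :=
  hv.linearIndepOn_id.mono hs

theorem fin_mk_one_eq {n : ℕ} (h : 1 < n + 1) : (⟨1, h⟩ : Fin (n + 1)) = 1 := by
  ext; simp [Nat.mod_eq_of_lt h]

theorem mem_LSet_iff {n : ℕ} (hn : 1 ≤ n) (x : TT n) :
    x ∈ LSet n ↔ (∃ k, x = eT (.lb k)) ∨ (∃ k, x = eT (.lt' k)) ∨
      x = eT (.ht 0) ∨ x = eT (.rt 0) ∨ x = eT .lv := by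
  simp only [LSet, Set.mem_iUnion]
  constructor
  · rintro ⟨_ | _ | m, hm⟩
    · rcases hm with rfl | rfl | rfl <;> simp [eT_inj]
    · rcases hm with rfl | rfl | rfl <;> simp [eT_inj]
    · simp only [LGen] at hm
      split_ifs at hm
      · rcases hm with rfl | rfl <;> simp [eT_inj]
      · rcases hm with rfl; simp [eT_inj]
      · exact hm.elim
  · rintro (⟨⟨_ | _ | m, hk⟩, rfl⟩ | ⟨⟨_ | _ | m, hk⟩, rfl⟩ | rfl | rfl | rfl)
    · exact ⟨0, by simp [LGen]⟩
    · exact ⟨1, by simp [LGen, fin_mk_one_eq]⟩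
    · exact ⟨m + 2, by simp [LGen, Nat.le_of_lt_succ hk]⟩
    · exact ⟨0, by simp [LGen]⟩
    · exact ⟨1, by simp [LGen, fin_mk_one_eq]⟩
    · exact ⟨m + 2, by simp [LGen, Nat.le_of_lt_succ hk]⟩
    · exact ⟨1, by simp [LGen]⟩
    · exact ⟨0, by simp [LGen]⟩
    · obtain ⟨p, rfl⟩ := Nat.exists_eq_add_of_le' hn
      exact ⟨p + 2, by simp [LGen]⟩

theorem mem_RSet_iff {n : ℕ} (hn : 1 ≤ n) (x : TT n) :
    x ∈ RSet n ↔ (∃ k, x = eT (.rb k)) ∨ (∃ k, x = eT (.rt k)) ∨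
      x = eT (.hb 0) ∨ x = eT (.lb 0) ∨ x = eT .rv := by
  simp only [RSet, Set.mem_iUnion]
  constructor
  · rintro ⟨_ | _ | m, hm⟩
    · rcases hm with rfl | rfl | rfl <;> simp [eT_inj]
    · rcases hm with rfl | rfl | rfl <;> simp [eT_inj]
    · simp only [RGen] at hm
      split_ifs at hm
      · rcases hm with rfl | rfl <;> simp [eT_inj]
      · rcases hm with rfl; simp [eT_inj]
      · exact hm.elim
  · rintro (⟨⟨_ | _ | m, hk⟩, rfl⟩ | ⟨⟨_ | _ | m, hk⟩, rfl⟩ | rfl | rfl | rfl)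
    · exact ⟨0, by simp [RGen]⟩
    · exact ⟨1, by simp [RGen, fin_mk_one_eq]⟩
    · exact ⟨m + 2, by simp [RGen, Nat.le_of_lt_succ hk]⟩
    · exact ⟨0, by simp [RGen]⟩
    · exact ⟨1, by simp [RGen, fin_mk_one_eq]⟩
    · exact ⟨m + 2, by simp [RGen, Nat.le_of_lt_succ hk]⟩
    · exact ⟨1, by simp [RGen]⟩
    · exact ⟨0, by simp [RGen]⟩
    · obtain ⟨p, rfl⟩ := Nat.exists_eq_add_of_le' hn
      exact ⟨p + 2, by simp [RGen]⟩

theorem mem_MSet_iff {n : ℕ} (hn : 1 ≤ n) (x : TT n) :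
    x ∈ MSet n ↔ (∃ b, 2 ≤ degT n b ∧ x = eT b) ∨
      x = eT (.lb 1) + eT (.ht 0) ∨ x = eT (.lt' 1) + eT (.ht 0) ∨
      x = eT (.hb 0) + eT (.rb 1) ∨ x = eT (.hb 0) + eT (.rt 1) ∨
      x = eT (.lb 0) ∨ x = eT (.rt 0) := by
  simp only [MSet, Set.mem_iUnion]
  constructor
  · rintro ⟨_ | _ | m, hm⟩
    · rcases hm with rfl | rfl <;> simp [eT_inj]
    · rcases hm with rfl | rfl | rfl | rfl <;> simp [eT_inj]
    · left
      simp only [MGen] at hm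
      split_ifs at hm
      · rcases hm with rfl | rfl | rfl | rfl | rfl | rfl <;>
          exact ⟨_, by simp [degT], rfl⟩
      · rcases hm with rfl | rfl | rfl | rfl <;> exact ⟨_, by simp [degT]; try omega, rfl⟩
      · rcases hm with rfl
        exact ⟨_, by simp [degT], rfl⟩
      · exact hm.elim
  · rintro (⟨b, hb, rfl⟩ | rfl | rfl | rfl | rfl | rfl | rfl)
    · obtain ⟨p, rfl⟩ := Nat.exists_eq_add_of_le' hn
      have hlast {k : Fin (p + 1 + 1)} (h : ¬ (k : ℕ) < p + 1) : k = Fin.last (p + 1) :=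
        Fin.ext (by simp only [Fin.val_last]; omega)
      rcases b with _ | _ | _ | k | k | k | k | k | k
      · exact ⟨p + 1 + 2, by simp [MGen]⟩
      · exact ⟨p + 2, by simp [MGen]⟩
      · exact ⟨p + 2, by simp [MGen]⟩
      · by_cases h : (k : ℕ) < p + 1
        · obtain ⟨_ | k, hk⟩ := k
          · simp [degT] at hb
          · exact ⟨k + 2, by simp_all [MGen]⟩
        · exact ⟨p + 2, by simp [MGen, hlast h]⟩
      · by_cases h : (k : ℕ) < p + 1
        · obtain ⟨_ | k, hk⟩ := k
          · simp [degT] at hb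
          · exact ⟨k + 2, by simp_all [MGen]⟩
        · exact ⟨p + 2, by simp [MGen, hlast h]⟩
      all_goals
        obtain ⟨_ | _ | k, hk⟩ := k
        · simp [degT] at hb
        · simp [degT] at hb
        · exact ⟨k + 2, by simp [MGen, Nat.le_of_lt_succ hk]⟩
    · exact ⟨1, by simp [MGen]⟩
    · exact ⟨1, by simp [MGen]⟩
    · exact ⟨1, by simp [MGen]⟩
    · exact ⟨1, by simp [MGen]⟩
    · exact ⟨0, by simp [MGen]⟩
    · exact ⟨0, by simp [MGen]⟩

theorem DT_mem_Lsub {n : ℕ} (hn : 1 ≤ n) : ∀ x ∈ Lsub n, DT n x ∈ Lsub n := by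
  have hb (k) : eT (.lb k) ∈ Lsub n := Submodule.subset_span (by simp [mem_LSet_iff hn, eT_inj])
  have ht (k) : eT (.lt' k) ∈ Lsub n := Submodule.subset_span (by simp [mem_LSet_iff hn, eT_inj])
  have hr : eT (.rt 0) ∈ Lsub n := Submodule.subset_span (by simp [mem_LSet_iff hn, eT_inj])
  refine map_mem_span_of_forall_mem fun x hx => ?_
  change DT n x ∈ Lsub n
  rcases (mem_LSet_iff hn x).1 hx with ⟨k, rfl⟩ | ⟨k, rfl⟩ | rfl | rfl | rfl <;>
    simp only [DT_eT, dTB]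
  · split_ifs
    exacts [sub_mem (ht _) (hb _), zero_mem _]
  · split_ifs
    exacts [sub_mem (ht _) (hb _), zero_mem _]
  · simpa using sub_mem hr (ht 0)
  · simp
  · exact sub_mem (ht _) (hb _)

theorem DT_mem_Rsub {n : ℕ} (hn : 1 ≤ n) : ∀ x ∈ Rsub n, DT n x ∈ Rsub n := by
  have hb (k) : eT (.rb k) ∈ Rsub n := Submodule.subset_span (by simp [mem_RSet_iff hn, eT_inj])
  have ht (k) : eT (.rt k) ∈ Rsub n := Submodule.subset_span (by simp [mem_RSet_iff hn, eT_inj])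
  have hl : eT (.lb 0) ∈ Rsub n := Submodule.subset_span (by simp [mem_RSet_iff hn, eT_inj])
  refine map_mem_span_of_forall_mem fun x hx => ?_
  change DT n x ∈ Rsub n
  rcases (mem_RSet_iff hn x).1 hx with ⟨k, rfl⟩ | ⟨k, rfl⟩ | rfl | rfl | rfl <;>
    simp only [DT_eT, dTB]
  · split_ifs
    exacts [sub_mem (ht _) (hb _), zero_mem _]
  · split_ifs
    exacts [sub_mem (ht _) (hb _), zero_mem _]
  · simpa using sub_mem (hb 0) hl
  · simp
  · exact sub_mem (ht _) (hb _)

theorem DT_mem_Msub {n : ℕ} (hn : 2 ≤ n) : ∀ x ∈ Msub n, DT n x ∈ Msub n := by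
  have hn1 : 1 ≤ n := by omega
  have hmod : 1 % (n + 1) = 1 := Nat.mod_eq_of_lt (by omega)
  have hv1 : ((1 : Fin (n + 1)) : ℕ) = 1 := by rw [← fin_mk_one_eq (by omega)]
  have he (b) (hb : 2 ≤ degT n b) : eT b ∈ Msub n :=
    Submodule.subset_span ((mem_MSet_iff hn1 _).2 (.inl ⟨b, hb, rfl⟩))
  have hlb : eT (.lb 1) + eT (.ht 0) ∈ Msub n :=
    Submodule.subset_span (by simp [mem_MSet_iff hn1])
  have hlt : eT (.lt' 1) + eT (.ht 0) ∈ Msub n :=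
    Submodule.subset_span (by simp [mem_MSet_iff hn1])
  have hrb : eT (.hb 0) + eT (.rb 1) ∈ Msub n :=
    Submodule.subset_span (by simp [mem_MSet_iff hn1])
  have hrt : eT (.hb 0) + eT (.rt 1) ∈ Msub n :=
    Submodule.subset_span (by simp [mem_MSet_iff hn1])
  have hl0 : eT (.lb 0) ∈ Msub n := Submodule.subset_span (by simp [mem_MSet_iff hn1])
  have hr0 : eT (.rt 0) ∈ Msub n := Submodule.subset_span (by simp [mem_MSet_iff hn1])
  have hl (k : Fin (n + 1)) (hk : 1 ≤ (k : ℕ)) : eT (.lt' k) - eT (.lb k) ∈ Msub n := by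
    rcases hk.eq_or_lt with h | h
    · obtain rfl : k = 1 := Fin.ext (by omega)
      simpa using sub_mem hlt hlb
    · exact sub_mem (he _ h) (he _ h)
  have hr (k : Fin (n + 1)) (hk : 1 ≤ (k : ℕ)) : eT (.rt k) - eT (.rb k) ∈ Msub n := by
    rcases hk.eq_or_lt with h | h
    · obtain rfl : k = 1 := Fin.ext (by omega)
      simpa using sub_mem hrt hrb
    · exact sub_mem (he _ h) (he _ h)
  have hd : eT (.rt 0) - eT (.lb 0) ∈ Msub n := sub_mem hr0 hl0
  refine map_mem_span_of_forall_mem fun x hx => ?_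
  change DT n x ∈ Msub n
  rcases (mem_MSet_iff hn1 x).1 hx with ⟨b, hb, rfl⟩ | rfl | rfl | rfl | rfl | rfl | rfl <;>
    simp only [map_add, DT_eT]
  · rcases b with _ | _ | _ | k | k | k | k | k | k <;> simp only [degT] at hb <;> simp only [dTB]
    · exact add_mem (sub_mem (sub_mem (he _ (by simp [degT]; omega)) (he _ (by simp [degT]; omega)))
        (he _ (by simp [degT]; omega))) (he _ (by simp [degT]; omega))
    · exact hl _ hn1
    · exact hr _ hn1
    · rw [if_pos (by omega)]
      rcases (show 1 ≤ (k : ℕ) by omega).eq_or_lt with h | h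
      · obtain rfl : k = 1 := Fin.ext (by omega)
        convert sub_mem hrb hlb using 1
        simp only [hv1, Nat.sub_self, Fin.mk_zero']
        abel
      · exact sub_mem (sub_mem (he _ h) (he _ h))
          (sub_mem (he _ (by simp only [degT]; omega)) (he _ (by simp only [degT]; omega)))
    · rw [if_pos (by omega)]
      rcases (show 1 ≤ (k : ℕ) by omega).eq_or_lt with h | h
      · obtain rfl : k = 1 := Fin.ext (by omega)
        convert sub_mem hrt hlt using 1
        simp only [hv1, Nat.sub_self, Fin.mk_zero']
        abel
      · exact sub_mem (sub_mem (he _ h) (he _ h))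
          (sub_mem (he _ (by simp only [degT]; omega)) (he _ (by simp only [degT]; omega)))
    · rw [if_pos (by omega)]
      exact hl _ (by simp only; omega)
    · rw [if_pos (by omega)]
      exact hl _ (by simp only; omega)
    · rw [if_pos (by omega)]
      exact hr _ (by simp only; omega)
    · rw [if_pos (by omega)]
      exact hr _ (by simp only; omega)
  · convert hd using 1
    simp [dTB, hmod]
  · convert hd using 1
    simp [dTB, hmod]
  · convert hd using 1
    simp [dTB, hmod]
  · convert hd using 1
    simp [dTB, hmod]
  · simp [dTB]
  · simp [dTB]

/-- The square-zero correction turning basis vectors into the degree-one generators of `M`. -/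
noncomputable def degOneShift (n : ℕ) : TT n →ₗ[ℤ] TT n :=
  Finsupp.linearCombination ℤ fun b =>
    if b = .lb 1 ∨ b = .lt' 1 then eT (.ht 0)
    else if b = .rb 1 ∨ b = .rt 1 then eT (.hb 0) else 0

theorem degOneShift_eT {n : ℕ} (b : TB n) :
    degOneShift n (eT b) = if b = .lb 1 ∨ b = .lt' 1 then eT (.ht 0)
      else if b = .rb 1 ∨ b = .rt 1 then eT (.hb 0) else 0 := by
  simp [degOneShift, eT]

theorem degOneShift_comp_self (n : ℕ) : degOneShift n ∘ₗ degOneShift n = 0 := by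
  refine Finsupp.lhom_ext' fun b => LinearMap.ext_ring ?_
  change degOneShift n (degOneShift n (eT b)) = 0
  rw [degOneShift_eT]
  split_ifs <;> simp [degOneShift_eT]

theorem linearIndependent_eT_add_degOneShift (n : ℕ) :
    LinearIndependent ℤ fun b : TB n => eT b + degOneShift n (eT b) := by
  let f : TT n →ₗ[ℤ] TT n := LinearMap.id + degOneShift n
  have hinv : Function.LeftInverse (fun x => x - degOneShift n x) f := fun x => by
    have h : degOneShift n (degOneShift n x) = 0 :=
      LinearMap.congr_fun (degOneShift_comp_self n) x
    change (x + degOneShift n x) - degOneShift n (x + degOneShift n x) = x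
    rw [map_add, h]
    abel
  exact (linearIndependent_eT n).map_injOn f hinv.injective.injOn

theorem MSet_subset_range {n : ℕ} (hn : 1 ≤ n) :
    MSet n ⊆ Set.range fun b : TB n => eT b + degOneShift n (eT b) := by
  have hv1 : ((1 : Fin (n + 1)) : ℕ) = 1 := by rw [← fin_mk_one_eq (by omega)]
  have h01 : (0 : Fin (n + 1)) ≠ 1 := fun h => by
    rw [Fin.ext_iff, hv1] at h
    exact zero_ne_one h
  intro x hx
  rcases (mem_MSet_iff hn x).1 hx with ⟨b, hb, rfl⟩ | rfl | rfl | rfl | rfl | rfl | rfl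
  · have h1 (c : TB n) (hc : degT n c = 1) : b ≠ c := by rintro rfl; omega
    refine ⟨b, ?_⟩
    simp [degOneShift_eT, h1 (.lb 1) hv1, h1 (.lt' 1) hv1, h1 (.rb 1) hv1, h1 (.rt 1) hv1]
  · exact ⟨.lb 1, by simp [degOneShift_eT]⟩
  · exact ⟨.lt' 1, by simp [degOneShift_eT]⟩
  · exact ⟨.rb 1, by simp [degOneShift_eT, add_comm]⟩
  · exact ⟨.rt 1, by simp [degOneShift_eT, add_comm]⟩
  · exact ⟨.lb 0, by simp [degOneShift_eT, h01]⟩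
  · exact ⟨.rt 0, by simp [degOneShift_eT, h01]⟩

/-- **The pieces of the lax shuffle decomposition are subcomplexes.**  For `n ≥ 3`,
the graded subgroups `L`, `M`, `R` of `T = I ⊗ G(n+1)` are each closed under the
differential of `T` (hence are chain subcomplexes), and each is free abelian with the
listed spanning elements as a basis (the generating families are linearly independent). -/
theorem LMR_subcomplexes_free (n : ℕ) (hn : 3 ≤ n) :
    ((∀ x ∈ Lsub n, DT n x ∈ Lsub n) ∧ LinearIndependent ℤ ((↑) : LSet n → TT n)) ∧
    ((∀ x ∈ Msub n, DT n x ∈ Msub n) ∧ LinearIndependent ℤ ((↑) : MSet n → TT n)) ∧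
    ((∀ x ∈ Rsub n, DT n x ∈ Rsub n) ∧ LinearIndependent ℤ ((↑) : RSet n → TT n)) := by
  have hn1 : 1 ≤ n := by omega
  refine ⟨⟨DT_mem_Lsub hn1, (linearIndependent_eT n).coe_of_subset_range fun x hx => ?_⟩,
    ⟨DT_mem_Msub (by omega),
      (linearIndependent_eT_add_degOneShift n).coe_of_subset_range (MSet_subset_range hn1)⟩,
    ⟨DT_mem_Rsub hn1, (linearIndependent_eT n).coe_of_subset_range fun x hx => ?_⟩⟩
  · rcases (mem_LSet_iff hn1 x).1 hx with ⟨k, rfl⟩ | ⟨k, rfl⟩ | rfl | rfl | rfl <;>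
      exact ⟨_, rfl⟩
  · rcases (mem_RSet_iff hn1 x).1 hx with ⟨k, rfl⟩ | ⟨k, rfl⟩ | rfl | rfl | rfl <;>
      exact ⟨_, rfl⟩
end

section
/- For every n ≥ 3, in T = I ⊗ G(n+1): the intersection L ∩ M is the graded subgroup spanned by ℓ⊗υ in degree n+1, by ℓ⊗β_k, ℓ⊗τ_k in degree k for 2 ≤ k ≤ n, by ℓ⊗β_1 + h⊗τ_0 and ℓ⊗τ_1 + h⊗τ_0 in degree 1, and by ℓ⊗β_0 and r⊗τ_0 in degree 0; the intersection M ∩ R is the graded subgroup spanned by r⊗υ in degree n+1, by r⊗β_k, r⊗τ_k in degree k for 2 ≤ k ≤ n, by h⊗β_0 + r⊗β_1 and h⊗β_0 + r⊗τ_1 in degree 1, and by ℓ⊗β_0 and r⊗τ_0 in degree 0. Moreover, each of L ∩ M and M ∩ R is isomorphic as a chain complex of abelian groups to the globe complex G(n+1). -/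
/-- Degree-`m` generators of the intersection `L ∩ M`. -/
def LMGen (n : ℕ) : ℕ → Set (TT n)
  | 0 => {eT (.lb 0), eT (.rt 0)}
  | 1 => {eT (.lb 1) + eT (.ht 0), eT (.lt' 1) + eT (.ht 0)}
  | m + 2 =>
      if h : m + 2 ≤ n then {eT (.lb ⟨m + 2, by omega⟩), eT (.lt' ⟨m + 2, by omega⟩)}
      else if m + 2 = n + 1 then {eT .lv}
      else ∅

/-- Degree-`m` generators of the intersection `M ∩ R`. -/
def MRGen (n : ℕ) : ℕ → Set (TT n)
  | 0 => {eT (.lb 0), eT (.rt 0)}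
  | 1 => {eT (.hb 0) + eT (.rb 1), eT (.hb 0) + eT (.rt 1)}
  | m + 2 =>
      if h : m + 2 ≤ n then {eT (.rb ⟨m + 2, by omega⟩), eT (.rt ⟨m + 2, by omega⟩)}
      else if m + 2 = n + 1 then {eT .rv}
      else ∅

/-- If a linear map fixes a set `S` and sends a set `T` into the span of `U ⊆ span S ∩ span T`,
then `U` spans the intersection of the spans of `S` and `T`. -/
theorem span_inf_span_eq_of_retraction {V : Type*} [AddCommGroup V] {S T U : Set V}
    (p : V →ₗ[ℤ] V) (hS : ∀ x ∈ S, p x = x) (hT : ∀ x ∈ T, p x ∈ Submodule.span ℤ U)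
    (hUS : ∀ x ∈ U, x ∈ Submodule.span ℤ S) (hUT : ∀ x ∈ U, x ∈ Submodule.span ℤ T) :
    Submodule.span ℤ S ⊓ Submodule.span ℤ T = Submodule.span ℤ U := by
  refine le_antisymm ?_ (le_inf (Submodule.span_le.2 hUS) (Submodule.span_le.2 hUT))
  rintro x ⟨hxS, hxT⟩
  have hfix : p x = x := LinearMap.eqOn_span (f := p) (g := LinearMap.id) hS hxS
  have hmap : Submodule.span ℤ T ≤ (Submodule.span ℤ U).comap p := Submodule.span_le.2 hT
  exact hfix ▸ hmap hxT

/-- A family in `T` indexed by the basis of the globe, homogeneous of the right degrees,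
compatible with the differentials, and separated by coordinates, extends to a
degree-preserving injective chain map. -/
theorem exists_globe_embedding {n : ℕ} (g : GlobeBasis (n + 1) → TT n)
    (s : GlobeBasis (n + 1) → TB n)
    (hs : ∀ b b', g b (s b') = if b = b' then 1 else 0)
    (hd : ∀ b, Finsupp.linearCombination ℤ g (dGB (n + 1) b) = DT n (g b))
    (hdeg : ∀ b, ∀ c ∈ (g b).support, degT n c = degG (n + 1) b) :
    ∃ ι : Globe (n + 1) →ₗ[ℤ] TT n, Function.Injective ι ∧
      LinearMap.range ι = Submodule.span ℤ (Set.range g) ∧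
      (∀ x : Globe (n + 1), ι (DG (n + 1) x) = DT n (ι x)) ∧
      (∀ (k : ℕ) (x : Globe (n + 1)), (∀ b ∈ x.support, degG (n + 1) b = k) →
        ∀ c ∈ (ι x).support, degT n c = k) := by
  classical
  refine ⟨Finsupp.linearCombination ℤ g, ?_, Finsupp.range_linearCombination ℤ, ?_, ?_⟩
  · have coord (x : Globe (n + 1)) (b : GlobeBasis (n + 1)) :
        Finsupp.linearCombination ℤ g x (s b) = x b := by
      have h : Finsupp.lapply (s b) ∘ₗ Finsupp.linearCombination ℤ g =
          (Finsupp.lapply b : Globe (n + 1) →ₗ[ℤ] ℤ) := by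
        ext b'
        simp [hs, Finsupp.single_apply]
      exact LinearMap.congr_fun h x
    intro x y hxy
    ext b
    rw [← coord x b, ← coord y b, hxy]
  · intro x
    have h : Finsupp.linearCombination ℤ g ∘ₗ DG (n + 1) =
        DT n ∘ₗ Finsupp.linearCombination ℤ g := by
      ext1 b
      ext1
      simpa [DG] using hd b
    exact LinearMap.congr_fun h x
  · intro k x hx c hc
    rw [Finsupp.linearCombination_apply] at hc
    obtain ⟨b, hb, hbc⟩ := Finset.mem_biUnion.1 (Finsupp.support_sum hc)
    rw [← hx b hb]
    exact hdeg b c (Finsupp.support_smul hbc)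

/-- The images in `L ∩ M` of the basis elements of the globe. -/
noncomputable def globeLM (n : ℕ) : GlobeBasis (n + 1) → TT n
  | .top => eT .lv
  | .β k => eT (.lb k) + if (k : ℕ) = 1 then eT (.ht 0) else 0
  | .τ k => if (k : ℕ) = 0 then eT (.rt 0) else
      eT (.lt' k) + if (k : ℕ) = 1 then eT (.ht 0) else 0

/-- A basis element of `T` occurring only in the corresponding value of `globeLM`. -/
def leadLM (n : ℕ) : GlobeBasis (n + 1) → TB n
  | .top => .lv
  | .β k => .lb k
  | .τ k => if (k : ℕ) = 0 then .rt 0 else .lt' k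

/-- The coordinate projection of `T` onto `L`. -/
noncomputable def projL (n : ℕ) : TT n →ₗ[ℤ] TT n :=
  Finsupp.linearCombination ℤ fun
    | .lv => eT .lv
    | .lb k => eT (.lb k)
    | .lt' k => eT (.lt' k)
    | .rt k => if (k : ℕ) = 0 then eT (.rt k) else 0
    | .ht k => if (k : ℕ) = 0 then eT (.ht k) else 0
    | _ => 0

/-- The images in `M ∩ R` of the basis elements of the globe. -/
noncomputable def globeMR (n : ℕ) : GlobeBasis (n + 1) → TT n
  | .top => eT .rv
  | .β k => if (k : ℕ) = 0 then eT (.lb 0) else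
      (if (k : ℕ) = 1 then eT (.hb 0) else 0) + eT (.rb k)
  | .τ k => (if (k : ℕ) = 1 then eT (.hb 0) else 0) + eT (.rt k)

/-- A basis element of `T` occurring only in the corresponding value of `globeMR`. -/
def leadMR (n : ℕ) : GlobeBasis (n + 1) → TB n
  | .top => .rv
  | .β k => if (k : ℕ) = 0 then .lb 0 else .rb k
  | .τ k => .rt k

/-- The coordinate projection of `T` onto `R`. -/
noncomputable def projR (n : ℕ) : TT n →ₗ[ℤ] TT n :=
  Finsupp.linearCombination ℤ fun
    | .rv => eT .rv
    | .rb k => eT (.rb k)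
    | .rt k => eT (.rt k)
    | .lb k => if (k : ℕ) = 0 then eT (.lb k) else 0
    | .hb k => if (k : ℕ) = 0 then eT (.hb k) else 0
    | _ => 0

theorem range_globeLM {n : ℕ} (hn : 1 ≤ n) :
    Set.range (globeLM n) = ⋃ m, LMGen n m := by
  have one_eq : (1 : Fin (n + 1)) = ⟨1, by omega⟩ := by
    ext
    simp [Nat.mod_eq_of_lt (show 1 < n + 1 by omega)]
  apply subset_antisymm
  · rintro _ ⟨b, rfl⟩
    refine Set.mem_iUnion.2 ⟨degG (n + 1) b, ?_⟩
    rcases b with _ | ⟨_ | _ | k, hk⟩ | ⟨_ | _ | k, hk⟩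
    · obtain ⟨m, rfl⟩ := Nat.exists_eq_add_of_le' hn
      simp [degG, LMGen, globeLM]
    all_goals simp [degG, LMGen, globeLM, one_eq]
    all_goals simp [show k + 2 ≤ n by omega]
  · refine Set.iUnion_subset fun m x hx => ?_
    rcases m with _ | _ | m
    · rcases hx with rfl | rfl
      · exact ⟨.β 0, by simp [globeLM]⟩
      · exact ⟨.τ 0, by simp [globeLM]⟩
    · rcases hx with rfl | rfl
      · exact ⟨.β 1, by simp [globeLM, one_eq]⟩
      · exact ⟨.τ 1, by simp [globeLM, one_eq]⟩
    · simp only [LMGen] at hx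
      split_ifs at hx with h h'
      · rcases hx with rfl | rfl
        · exact ⟨.β ⟨m + 2, by omega⟩, by simp [globeLM]⟩
        · exact ⟨.τ ⟨m + 2, by omega⟩, by simp [globeLM]⟩
      · obtain rfl := hx
        exact ⟨.top, rfl⟩
      · exact hx.elim

theorem range_globeMR {n : ℕ} (hn : 1 ≤ n) :
    Set.range (globeMR n) = ⋃ m, MRGen n m := by
  have one_eq : (1 : Fin (n + 1)) = ⟨1, by omega⟩ := by
    ext
    simp [Nat.mod_eq_of_lt (show 1 < n + 1 by omega)]
  apply subset_antisymm
  · rintro _ ⟨b, rfl⟩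
    refine Set.mem_iUnion.2 ⟨degG (n + 1) b, ?_⟩
    rcases b with _ | ⟨_ | _ | k, hk⟩ | ⟨_ | _ | k, hk⟩
    · obtain ⟨m, rfl⟩ := Nat.exists_eq_add_of_le' hn
      simp [degG, MRGen, globeMR]
    all_goals simp [degG, MRGen, globeMR, one_eq]
    all_goals simp [show k + 2 ≤ n by omega]
  · refine Set.iUnion_subset fun m x hx => ?_
    rcases m with _ | _ | m
    · rcases hx with rfl | rfl
      · exact ⟨.β 0, by simp [globeMR]⟩
      · exact ⟨.τ 0, by simp [globeMR]⟩
    · rcases hx with rfl | rfl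
      · exact ⟨.β 1, by simp [globeMR, one_eq]⟩
      · exact ⟨.τ 1, by simp [globeMR, one_eq]⟩
    · simp only [MRGen] at hx
      split_ifs at hx with h h'
      · rcases hx with rfl | rfl
        · exact ⟨.β ⟨m + 2, by omega⟩, by simp [globeMR]⟩
        · exact ⟨.τ ⟨m + 2, by omega⟩, by simp [globeMR]⟩
      · obtain rfl := hx
        exact ⟨.top, rfl⟩
      · exact hx.elim

theorem projL_of_mem_LSet {n : ℕ} {x : TT n} (hx : x ∈ LSet n) :
    projL n x = x := by
  obtain ⟨m, hx⟩ := Set.mem_iUnion.1 hx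
  rcases m with _ | _ | m
  · rcases hx with rfl | rfl | rfl <;> simp [projL, eT]
  · rcases hx with rfl | rfl | rfl <;> simp [projL, eT]
  · simp only [LGen] at hx
    split_ifs at hx
    · rcases hx with rfl | rfl <;> simp [projL, eT]
    · obtain rfl := hx
      simp [projL, eT]
    · exact hx.elim

theorem projL_mem_of_mem_MSet {n : ℕ} (hn : 1 ≤ n) {x : TT n} (hx : x ∈ MSet n) :
    projL n x ∈ Submodule.span ℤ (⋃ m, LMGen n m) := by
  obtain ⟨m, hx⟩ := Set.mem_iUnion.1 hx
  suffices h : projL n x = 0 ∨ projL n x ∈ LMGen n m by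
    rcases h with h | h
    · exact h ▸ zero_mem _
    · exact Submodule.subset_span (Set.mem_iUnion.2 ⟨m, h⟩)
  rcases m with _ | _ | m
  · rcases hx with rfl | rfl <;> simp [projL, LMGen, eT]
  · rcases hx with rfl | rfl | rfl | rfl <;> simp [projL, LMGen, eT, show n ≠ 0 by omega]
  · simp only [MGen] at hx
    split_ifs at hx with h h' h''
    · rcases hx with rfl | rfl | rfl | rfl | rfl | rfl <;> simp [projL, LMGen, eT, h]
    · have hm : m + 1 = n := by omega
      rcases hx with rfl | rfl | rfl | rfl <;>
        simp [projL, LMGen, eT, h, hm, show n ≠ 0 by omega]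
    · obtain rfl := hx
      simp [projL, eT]
    · exact hx.elim

theorem LMGen_subset_MGen (n m : ℕ) : LMGen n m ⊆ MGen n m := by
  rcases m with _ | _ | m
  · exact subset_rfl
  · rintro x (rfl | rfl) <;> simp [MGen]
  · simp only [LMGen, MGen]
    split_ifs
    · rintro x (rfl | rfl) <;> simp
    · rintro x rfl
      simp
    all_goals exact Set.empty_subset _

theorem LMGen_subset_span_LGen (n m : ℕ) :
    LMGen n m ⊆ Submodule.span ℤ (LGen n m) := by
  rcases m with _ | _ | m
  · rintro x (rfl | rfl) <;> exact Submodule.subset_span (by simp [LGen])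
  · rintro x (rfl | rfl) <;>
      exact add_mem (Submodule.subset_span (by simp [LGen]))
        (Submodule.subset_span (by simp [LGen]))
  · exact Submodule.subset_span

theorem Lsub_inf_Msub {n : ℕ} (hn : 1 ≤ n) :
    Lsub n ⊓ Msub n = Submodule.span ℤ (⋃ m, LMGen n m) := by
  refine span_inf_span_eq_of_retraction (projL n) (fun x => projL_of_mem_LSet)
    (fun x => projL_mem_of_mem_MSet hn) (fun x hx => ?_) fun x hx => ?_
  · obtain ⟨m, hx⟩ := Set.mem_iUnion.1 hx
    exact Submodule.span_mono (Set.subset_iUnion _ m) (LMGen_subset_span_LGen n m hx)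
  · obtain ⟨m, hx⟩ := Set.mem_iUnion.1 hx
    exact Submodule.subset_span (Set.mem_iUnion.2 ⟨m, LMGen_subset_MGen n m hx⟩)

theorem exists_globe_embedding_LM {n : ℕ} (hn : 1 ≤ n) :
    ∃ ι : Globe (n + 1) →ₗ[ℤ] TT n, Function.Injective ι ∧
      LinearMap.range ι = Submodule.span ℤ (⋃ m, LMGen n m) ∧
      (∀ x : Globe (n + 1), ι (DG (n + 1) x) = DT n (ι x)) ∧
      (∀ (k : ℕ) (x : Globe (n + 1)), (∀ b ∈ x.support, degG (n + 1) b = k) →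
        ∀ c ∈ (ι x).support, degT n c = k) := by
  rw [← range_globeLM hn]
  refine exists_globe_embedding (globeLM n) (leadLM n) ?_ ?_ ?_
  · rintro (_ | ⟨_ | _ | k, hk⟩ | ⟨_ | _ | k, hk⟩) (_ | ⟨_ | k', hk'⟩ | ⟨_ | k', hk'⟩) <;>
      simp [globeLM, leadLM, eT, Finsupp.single_apply]
  · rintro (_ | ⟨_ | _ | _ | k, hk⟩ | ⟨_ | _ | _ | k, hk⟩)
    all_goals simp [globeLM, dGB, DT_eT, dTB, Fin.last, show n ≠ 0 by omega]
  · rintro (_ | ⟨_ | _ | k, hk⟩ | ⟨_ | _ | k, hk⟩) c hc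
    all_goals
      simp [globeLM, degG, eT, Finsupp.single_apply] at hc ⊢
    all_goals grind [degT, Fin.val_zero]

theorem projR_of_mem_RSet {n : ℕ} {x : TT n} (hx : x ∈ RSet n) :
    projR n x = x := by
  obtain ⟨m, hx⟩ := Set.mem_iUnion.1 hx
  rcases m with _ | _ | m
  · rcases hx with rfl | rfl | rfl <;> simp [projR, eT]
  · rcases hx with rfl | rfl | rfl <;> simp [projR, eT]
  · simp only [RGen] at hx
    split_ifs at hx
    · rcases hx with rfl | rfl <;> simp [projR, eT]
    · obtain rfl := hx
      simp [projR, eT]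
    · exact hx.elim

theorem projR_mem_of_mem_MSet {n : ℕ} (hn : 1 ≤ n) {x : TT n} (hx : x ∈ MSet n) :
    projR n x ∈ Submodule.span ℤ (⋃ m, MRGen n m) := by
  obtain ⟨m, hx⟩ := Set.mem_iUnion.1 hx
  suffices h : projR n x = 0 ∨ projR n x ∈ MRGen n m by
    rcases h with h | h
    · exact h ▸ zero_mem _
    · exact Submodule.subset_span (Set.mem_iUnion.2 ⟨m, h⟩)
  rcases m with _ | _ | m
  · rcases hx with rfl | rfl <;> simp [projR, MRGen, eT]
  · rcases hx with rfl | rfl | rfl | rfl <;> simp [projR, MRGen, eT, show n ≠ 0 by omega]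
  · simp only [MGen] at hx
    split_ifs at hx with h h' h''
    · rcases hx with rfl | rfl | rfl | rfl | rfl | rfl <;> simp [projR, MRGen, eT, h]
    · have hm : m + 1 = n := by omega
      rcases hx with rfl | rfl | rfl | rfl <;>
        simp [projR, MRGen, eT, h, hm, show n ≠ 0 by omega]
    · obtain rfl := hx
      simp [projR, eT]
    · exact hx.elim

theorem MRGen_subset_MGen (n m : ℕ) : MRGen n m ⊆ MGen n m := by
  rcases m with _ | _ | m
  · exact subset_rfl
  · rintro x (rfl | rfl) <;> simp [MGen]
  · simp only [MRGen, MGen]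
    split_ifs
    · rintro x (rfl | rfl) <;> simp
    · rintro x rfl
      simp
    all_goals exact Set.empty_subset _

theorem MRGen_subset_span_RGen (n m : ℕ) :
    MRGen n m ⊆ Submodule.span ℤ (RGen n m) := by
  rcases m with _ | _ | m
  · rintro x (rfl | rfl) <;> exact Submodule.subset_span (by simp [RGen])
  · rintro x (rfl | rfl) <;>
      exact add_mem (Submodule.subset_span (by simp [RGen]))
        (Submodule.subset_span (by simp [RGen]))
  · exact Submodule.subset_span

theorem Msub_inf_Rsub {n : ℕ} (hn : 1 ≤ n) :
    Msub n ⊓ Rsub n = Submodule.span ℤ (⋃ m, MRGen n m) := by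
  rw [inf_comm]
  refine span_inf_span_eq_of_retraction (projR n) (fun x => projR_of_mem_RSet)
    (fun x => projR_mem_of_mem_MSet hn) (fun x hx => ?_) fun x hx => ?_
  · obtain ⟨m, hx⟩ := Set.mem_iUnion.1 hx
    exact Submodule.span_mono (Set.subset_iUnion _ m) (MRGen_subset_span_RGen n m hx)
  · obtain ⟨m, hx⟩ := Set.mem_iUnion.1 hx
    exact Submodule.subset_span (Set.mem_iUnion.2 ⟨m, MRGen_subset_MGen n m hx⟩)

theorem exists_globe_embedding_MR {n : ℕ} (hn : 1 ≤ n) :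
    ∃ ι : Globe (n + 1) →ₗ[ℤ] TT n, Function.Injective ι ∧
      LinearMap.range ι = Submodule.span ℤ (⋃ m, MRGen n m) ∧
      (∀ x : Globe (n + 1), ι (DG (n + 1) x) = DT n (ι x)) ∧
      (∀ (k : ℕ) (x : Globe (n + 1)), (∀ b ∈ x.support, degG (n + 1) b = k) →
        ∀ c ∈ (ι x).support, degT n c = k) := by
  rw [← range_globeMR hn]
  refine exists_globe_embedding (globeMR n) (leadMR n) ?_ ?_ ?_
  · rintro (_ | ⟨_ | _ | k, hk⟩ | ⟨_ | _ | k, hk⟩) (_ | ⟨_ | k', hk'⟩ | ⟨_ | k', hk'⟩) <;>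
      simp [globeMR, leadMR, eT, Finsupp.single_apply]
  · rintro (_ | ⟨_ | _ | _ | k, hk⟩ | ⟨_ | _ | _ | k, hk⟩)
    all_goals simp [globeMR, dGB, DT_eT, dTB, Fin.last, show n ≠ 0 by omega]
  · rintro (_ | ⟨_ | _ | k, hk⟩ | ⟨_ | _ | k, hk⟩) c hc
    all_goals
      simp [globeMR, degG, eT, Finsupp.single_apply] at hc ⊢
    all_goals grind [degT, Fin.val_zero]

/-- **The intersections in the lax shuffle decomposition are globes.**  For `n ≥ 3`, in
`T = I ⊗ G(n+1)`: `L ∩ M` is the graded subgroup spanned by `ℓ⊗υ`; `ℓ⊗β_k, ℓ⊗τ_k`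
(`2 ≤ k ≤ n`); `ℓ⊗β_1 + h⊗τ_0, ℓ⊗τ_1 + h⊗τ_0`; `ℓ⊗β_0, r⊗τ_0`, and `M ∩ R` is the
graded subgroup spanned by `r⊗υ`; `r⊗β_k, r⊗τ_k` (`2 ≤ k ≤ n`);
`h⊗β_0 + r⊗β_1, h⊗β_0 + r⊗τ_1`; `ℓ⊗β_0, r⊗τ_0`.  Moreover each of `L ∩ M` and
`M ∩ R` is isomorphic, as a chain complex of abelian groups (via a degree-preserving
injective homomorphism commuting with the differentials), to the globe complex `G(n+1)`. -/
theorem LM_MR_intersections (n : ℕ) (hn : 3 ≤ n) :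
    Lsub n ⊓ Msub n = Submodule.span ℤ (⋃ m, LMGen n m) ∧
    Msub n ⊓ Rsub n = Submodule.span ℤ (⋃ m, MRGen n m) ∧
    (∃ ι : Globe (n + 1) →ₗ[ℤ] TT n, Function.Injective ι ∧
      LinearMap.range ι = Lsub n ⊓ Msub n ∧
      (∀ x : Globe (n + 1), ι (DG (n + 1) x) = DT n (ι x)) ∧
      (∀ (k : ℕ) (x : Globe (n + 1)), (∀ b ∈ x.support, degG (n + 1) b = k) →
        ∀ c ∈ (ι x).support, degT n c = k)) ∧
    (∃ ι : Globe (n + 1) →ₗ[ℤ] TT n, Function.Injective ι ∧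
      LinearMap.range ι = Msub n ⊓ Rsub n ∧
      (∀ x : Globe (n + 1), ι (DG (n + 1) x) = DT n (ι x)) ∧
      (∀ (k : ℕ) (x : Globe (n + 1)), (∀ b ∈ x.support, degG (n + 1) b = k) →
        ∀ c ∈ (ι x).support, degT n c = k)) := by
  have hn' : 1 ≤ n := by omega
  rw [Lsub_inf_Msub hn', Msub_inf_Rsub hn']
  exact ⟨rfl, rfl, exists_globe_embedding_LM hn', exists_globe_embedding_MR hn'⟩
end
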